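/- For real x > 0 and any nonnegative integer n, the Scorer function Gi satisfies Gi(x) = (1/(πx)) Σ_{k=0}^{n} (3k)!/(k!(3x³)^k) + (1/π) ε(x), where |ε(x)| ≤ (3n+3)! / (3^{(5n/2)+3} (n+1)! (x/2)^{3n+4}). -/

import Mathlib

open scoped Real
open Finset Filter

lemma sc_int_real (r : ℝ) (hr : 0 < r) (m : ℕ) :
    MeasureTheory.IntegrableOn (fun t : ℝ => t ^ m * Real.exp (-(r * t))) (Set.Ioi 0) ∧
    ∫ t : ℝ in Set.Ioi 0, t ^ m * Real.exp (-(r * t)) = (m.factorial : ℝ) / r ^ (m + 1) := by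
  constructor
  · have := integrableOn_rpow_mul_exp_neg_mul_rpow (p := 1) (s := m) (b := r)
      (by have : (0:ℝ) ≤ m := by positivity
          linarith) one_pos hr
    refine this.congr_fun (fun t ht => ?_) measurableSet_Ioi
    simp [neg_mul]
  · have := Real.integral_rpow_mul_exp_neg_mul_Ioi (a := m + 1) (r := r) (by positivity) hr
    rw [Real.Gamma_nat_eq_factorial] at this
    simp only [add_sub_cancel_right, Real.rpow_natCast] at this
    rw [this, show ((m:ℝ) + 1) = ((m + 1 : ℕ) : ℝ) by push_cast; rfl, Real.rpow_natCast]
    rw [one_div, inv_pow]; field_simp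

lemma sc_norm_exp (a : ℂ) (t : ℝ) : ‖Complex.exp (-(a * t))‖ = Real.exp (-(a.re * t)) := by
  rw [Complex.norm_exp]; simp

lemma sc_int_cplx_int (a : ℂ) (ha : 0 < a.re) (m : ℕ) :
    MeasureTheory.IntegrableOn (fun t : ℝ => (t : ℂ) ^ m * Complex.exp (-(a * t))) (Set.Ioi 0) := by
  refine MeasureTheory.Integrable.mono' (sc_int_real a.re ha m).1 ?_ ?_
  · exact Continuous.aestronglyMeasurable (by fun_prop)
  · filter_upwards [MeasureTheory.ae_restrict_mem measurableSet_Ioi] with t ht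
    rw [norm_mul, sc_norm_exp, norm_pow, Complex.norm_real, Real.norm_of_nonneg (le_of_lt ht)]

lemma sc_int_cplx (a : ℂ) (ha : 0 < a.re) (m : ℕ) :
    ∫ t : ℝ in Set.Ioi 0, (t : ℂ) ^ m * Complex.exp (-(a * t)) =
      (m.factorial : ℂ) / a ^ (m + 1) := by
  have ha0 : a ≠ 0 := by rintro rfl; simp at ha
  induction m with
  | zero =>
    have := integral_exp_mul_complex_Ioi (a := -a) (by simpa using ha) 0
    simp only [pow_zero, one_mul, ← neg_mul]
    rw [this]; simp [neg_div_neg_eq]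
  | succ m ih =>
    have h1 := sc_int_cplx_int a ha m
    have h2 := sc_int_cplx_int a ha (m + 1)
    have h := MeasureTheory.integral_Ioi_of_hasDerivAt_of_tendsto' (a := 0) (m := 0)
      (f := fun t : ℝ => (t : ℂ) ^ (m + 1) * Complex.exp (-(a * t)))
      (f' := fun t : ℝ => ((m:ℂ) + 1) * ((t : ℂ) ^ m * Complex.exp (-(a * t))) -
        a * ((t : ℂ) ^ (m + 1) * Complex.exp (-(a * t)))) ?_
        ((h1.const_mul _).sub (h2.const_mul _)) ?_
    · rw [MeasureTheory.integral_sub (h1.const_mul _) (h2.const_mul _),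
        MeasureTheory.integral_const_mul, MeasureTheory.integral_const_mul, ih] at h
      simp only [Complex.ofReal_zero, zero_pow (Nat.succ_ne_zero m), zero_mul, sub_zero] at h
      have h' := (sub_eq_zero.mp h).symm
      rw [Nat.factorial_succ]
      push_cast
      rw [eq_div_iff (by positivity)]
      rw [← mul_div_assoc, eq_div_iff (by positivity)] at h'
      rw [← h']; ring
    · intro t _
      have e1 : HasDerivAt (fun t : ℝ => (t : ℂ)) 1 t := Complex.ofRealCLM.hasDerivAt
      have := (e1.pow (m + 1)).mul ((e1.const_mul a).neg.cexp)
      convert! this using 1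
      simp; ring
    · rw [tendsto_zero_iff_norm_tendsto_zero]
      have h3 := Real.tendsto_pow_mul_exp_neg_atTop_nhds_zero (m + 1)
      have h4 := h3.comp (tendsto_id.const_mul_atTop ha)
      have h5 := h4.const_mul ((a.re ^ (m + 1))⁻¹)
      rw [mul_zero] at h5
      refine h5.congr' ?_
      filter_upwards [eventually_ge_atTop 0] with t ht
      rw [norm_mul, sc_norm_exp, norm_pow, Complex.norm_real, Real.norm_of_nonneg ht]
      simp [mul_pow]; field_simp

lemma sc_taylor (n : ℕ) : ∀ y : ℝ, 0 ≤ y →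
    ‖Complex.exp (-(Complex.I * y)) - ∑ k ∈ Finset.range n, (-(Complex.I * y)) ^ k / (k.factorial : ℂ)‖
      ≤ y ^ n / (n.factorial : ℝ) := by
  induction n with
  | zero =>
    intro y hy
    simp
    rw [Complex.norm_exp]; simp
  | succ n ih =>
    intro y hy
    refine image_norm_le_of_norm_deriv_right_le_deriv_boundary (a := 0) (b := y)
      (f := fun y : ℝ => Complex.exp (-(Complex.I * y)) -
        ∑ k ∈ Finset.range (n + 1), (-(Complex.I * y)) ^ k / (k.factorial : ℂ))
      (f' := fun y : ℝ => -Complex.I * (Complex.exp (-(Complex.I * y)) -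
        ∑ k ∈ Finset.range n, (-(Complex.I * y)) ^ k / (k.factorial : ℂ)))
      (B := fun y => y ^ (n + 1) / ((n + 1).factorial : ℝ))
      (B' := fun y => y ^ n / (n.factorial : ℝ)) (by fun_prop) ?_ ?_ ?_ ?_ ⟨hy, le_rfl⟩
    · intro t _
      apply HasDerivAt.hasDerivWithinAt
      have e1 : HasDerivAt (fun t : ℝ => (t : ℂ)) 1 t := Complex.ofRealCLM.hasDerivAt
      have e2 := (e1.const_mul Complex.I).neg
      simp_rw [Finset.sum_range_succ']
      have e3 : HasDerivAt (fun y : ℝ => ∑ k ∈ Finset.range n,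
          (-(Complex.I * y)) ^ (k + 1) / ((k + 1).factorial : ℂ))
          (∑ k ∈ Finset.range n, -Complex.I * ((-(Complex.I * t)) ^ k / (k.factorial : ℂ))) t := by
        refine HasDerivAt.fun_sum fun k _ => ?_
        have := (e2.pow (k + 1)).div_const ((k + 1).factorial : ℂ)
        convert! this using 1
        rw [Nat.factorial_succ]
        have : (k.factorial : ℂ) ≠ 0 := by exact_mod_cast k.factorial_ne_zero
        have : (k:ℂ) + 1 ≠ 0 := by exact_mod_cast k.succ_ne_zero
        push_cast
        simp
        field_simp
      have := e2.cexp.sub (e3.add_const ((-(Complex.I * t)) ^ 0 / ((0:ℕ).factorial : ℂ)))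
      rw [← Finset.mul_sum] at this
      convert! this using 1
      simp only [Pi.neg_apply]
      ring
    · simp [Finset.sum_range_succ']
    · intro t
      have := (hasDerivAt_pow (n + 1) t).div_const ((n + 1).factorial : ℝ)
      convert! this using 1
      rw [Nat.factorial_succ]
      push_cast
      field_simp
    · intro t ht
      rw [norm_mul, norm_neg, Complex.norm_I, one_mul]
      exact ih t ht.1

/-- The entire integrand. -/
noncomputable def scF (x : ℝ) (z : ℂ) : ℂ := Complex.exp (Complex.I * (z ^ 3 / 3 + x * z))

/-- The direction of the rotated ray, `e^{iπ/3}`. -/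
noncomputable def scW : ℂ := ⟨1 / 2, √3 / 2⟩

lemma scW_cube : scW ^ 3 = -1 := by
  have h : √3 * √3 = 3 := Real.mul_self_sqrt (by norm_num)
  rw [pow_succ, pow_two]
  apply Complex.ext <;> simp [scW] <;> ring_nf <;> nlinarith [h, congrArg (· * √3) h]

lemma scW_normsq : ‖scW‖ = 1 := by
  have h : √3 * √3 = 3 := Real.mul_self_sqrt (by norm_num)
  rw [Complex.norm_def, Complex.normSq_apply]
  simp only [scW]
  rw [show (1 / 2 * (1 / 2) + √3 / 2 * (√3 / 2) : ℝ) = 1 by nlinarith]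
  simp

lemma scF_norm (x T y : ℝ) :
    ‖scF x (T + y * Complex.I)‖ = Real.exp (-(T ^ 2 * y - y ^ 3 / 3 + x * y)) := by
  have : Complex.I * (((T:ℂ) + y * Complex.I) ^ 3 / 3 + x * (T + y * Complex.I)) =
      ((-(T ^ 2 * y - y ^ 3 / 3 + x * y) : ℝ) : ℂ) +
      ((T ^ 3 / 3 - T * y ^ 2 + x * T : ℝ) : ℂ) * Complex.I := by
    push_cast
    linear_combination (norm := ring_nf) (T ^ 2 * y + x * y - y ^ 3 / 3 +  T * y ^ 2 * Complex.I + y ^ 3 / 3 * Complex.I ^ 2) * Complex.I_sq 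
  rw [scF, Complex.norm_exp, this]
  simp [- Complex.ofReal_add, - Complex.ofReal_neg, - Complex.ofReal_sub, -Complex.ofReal_mul,
    -Complex.ofReal_pow, -Complex.ofReal_div]

lemma scF_ray (x s : ℝ) : scF x (s * scW) =
    Complex.exp (-(Complex.I * ((s ^ 3 / 3 : ℝ) : ℂ))) *
      Complex.exp (-((-(Complex.I * x * scW)) * s)) := by
  rw [scF, ← Complex.exp_add]
  congr 1
  push_cast
  linear_combination (Complex.I * s ^ 3 / 3) * scW_cube

lemma scA_re (x : ℝ) : (-(Complex.I * x * scW)).re = x * (√3 / 2) := by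
  simp [scW]

lemma sc_edge (x : ℝ) (hx : 0 < x) (G : ℂ → ℂ) (hG : ∀ z, HasDerivAt G (scF x z) z) (T : ℝ)
    (hT : 0 < T) :
    ‖G (((2 * T : ℝ) : ℂ) * scW) - G T‖ ≤ 3 / (2 * T ^ 2) + √3 * (T * Real.exp (-(x * T))) := by
  have hs : √3 * √3 = 3 := Real.mul_self_sqrt (by norm_num)
  have hs0 : 0 ≤ √3 := Real.sqrt_nonneg _
  have hY : 0 ≤ √3 * T := by positivity
  have e : ((2 * T : ℝ) : ℂ) * scW = T + ((√3 * T : ℝ) : ℂ) * Complex.I := by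
    apply Complex.ext <;> simp [scW] <;> ring
  have main := image_norm_le_of_norm_deriv_right_le_deriv_boundary (a := 0) (b := √3 * T)
      (f := fun y : ℝ => G (T + y * Complex.I) - G T)
      (f' := fun y : ℝ => scF x (T + y * Complex.I) * Complex.I)
      (B := fun y => 3 / (2 * T ^ 2) * (1 - Real.exp (-(2 / 3 * T ^ 2 * y))) +
        y * Real.exp (-(x * T)))
      (B' := fun y => Real.exp (-(2 / 3 * T ^ 2 * y)) + Real.exp (-(x * T))) ?_ ?_ ?_ ?_ ?_
      (x := √3 * T) ⟨hY, le_rfl⟩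
  · rw [e]
    refine main.trans ?_
    have h1 : 3 / (2 * T ^ 2) * (1 - Real.exp (-(2 / 3 * T ^ 2 * (√3 * T)))) ≤ 3 / (2 * T ^ 2) := by
      have : 0 < Real.exp (-(2 / 3 * T ^ 2 * (√3 * T))) := Real.exp_pos _
      have h3 : 0 ≤ 3 / (2 * T ^ 2) := by positivity
      nlinarith
    linarith
  · have : Continuous G := continuous_iff_continuousAt.2 fun z => (hG z).continuousAt
    fun_prop
  · intro y _
    apply HasDerivAt.hasDerivWithinAt
    have e1 : HasDerivAt (fun t : ℝ => (t : ℂ)) 1 y := Complex.ofRealCLM.hasDerivAt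
    have e2 := (e1.mul_const Complex.I).const_add (T:ℂ)
    have := ((hG _).comp y e2).sub_const (G T)
    simpa using this
  · simp
  · intro y
    have h1 : HasDerivAt (fun y : ℝ => -(2 / 3 * T ^ 2 * y)) (-(2 / 3 * T ^ 2)) y := by
      simpa using ((hasDerivAt_id y).const_mul (2 / 3 * T ^ 2)).fun_neg
    have h2 := ((h1.exp.const_sub 1).const_mul (3 / (2 * T ^ 2))).add
      ((hasDerivAt_id y).mul_const (Real.exp (-(x * T))))
    convert! h2 using 1
    field_simp
  · rintro y ⟨hy0, hy1⟩
    rw [norm_mul, Complex.norm_I, mul_one, scF_norm]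
    have hy2 : y ^ 2 ≤ 3 * T ^ 2 := by nlinarith
    rcases le_total y T with h | h
    · have : Real.exp (-(T ^ 2 * y - y ^ 3 / 3 + x * y)) ≤ Real.exp (-(2 / 3 * T ^ 2 * y)) := by
        apply Real.exp_le_exp.2
        have h1 : y ^ 2 ≤ T ^ 2 := by gcongr
        nlinarith [mul_nonneg hx.le hy0, mul_nonneg hy0 (sub_nonneg.2 h1)]
      linarith [Real.exp_pos (-(x * T))]
    · have : Real.exp (-(T ^ 2 * y - y ^ 3 / 3 + x * y)) ≤ Real.exp (-(x * T)) := by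
        apply Real.exp_le_exp.2
        nlinarith [mul_nonneg hx.le (sub_nonneg.2 h), mul_nonneg hy0 (sub_nonneg.2 hy2)]
      linarith [Real.exp_pos (-(2 / 3 * T ^ 2 * y))]

lemma scF_diff (x : ℝ) : Differentiable ℂ (scF x) := by
  unfold scF; fun_prop

lemma scF_ray_int (x : ℝ) (hx : 0 < x) :
    MeasureTheory.IntegrableOn (fun s : ℝ => scF x (s * scW)) (Set.Ioi 0) := by
  have ha : 0 < (-(Complex.I * x * scW)).re := by rw [scA_re]; positivity
  refine MeasureTheory.Integrable.mono' (sc_int_real _ ha 0).1 ?_ ?_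
  · have := (scF_diff x).continuous
    exact Continuous.aestronglyMeasurable (by fun_prop)
  · refine Eventually.of_forall fun t => ?_
    rw [scF_ray, norm_mul, sc_norm_exp, sc_norm_exp]
    simp

lemma sc_tendsto (x : ℝ) (hx : 0 < x) :
    Tendsto (fun T : ℝ => ∫ t in (0:ℝ)..T, Real.sin (t ^ 3 / 3 + x * t)) atTop
      (nhds (scW * ∫ s : ℝ in Set.Ioi 0, scF x (s * scW)).im) := by
  obtain ⟨G, hG'⟩ := (scF_diff x).isExactOn_univ
  have hG : ∀ z, HasDerivAt G (scF x z) z := fun z => hG' z trivial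
  have hc := (scF_diff x).continuous
  have hray : ∀ (w : ℂ) (T : ℝ), (∫ s in (0:ℝ)..T, w * scF x (s * w)) = G (T * w) - G 0 := by
    intro w T
    have := intervalIntegral.integral_eq_sub_of_hasDerivAt (a := 0) (b := T)
      (f := fun s : ℝ => G (s * w)) (f' := fun s : ℝ => w * scF x (s * w)) ?_ ?_
    · simpa using this
    · intro s _
      have e1 : HasDerivAt (fun t : ℝ => (t : ℂ)) 1 s := Complex.ofRealCLM.hasDerivAt
      have := (hG _).comp s (e1.mul_const w)
      convert! this using 1
      ring
    · exact Continuous.intervalIntegrable (by fun_prop) _ _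
  have h1 : Tendsto (fun T : ℝ => ∫ s in (0:ℝ)..(2 * T), scW * scF x (s * scW)) atTop
      (nhds (scW * ∫ s : ℝ in Set.Ioi 0, scF x (s * scW))) := by
    rw [← MeasureTheory.integral_const_mul]
    exact MeasureTheory.intervalIntegral_tendsto_integral_Ioi 0 ((scF_ray_int x hx).const_mul _)
      (tendsto_id.const_mul_atTop two_pos)
  have h2 : Tendsto (fun T : ℝ => G (((2 * T : ℝ) : ℂ) * scW) - G T) atTop (nhds 0) := by
    refine squeeze_zero_norm' (a := fun T : ℝ => 3 / (2 * T ^ 2) + √3 * (T * Real.exp (-(x * T)))) ?_ ?_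
    · filter_upwards [eventually_gt_atTop 0] with T hT using sc_edge x hx G hG T hT
    · have a1 : Tendsto (fun T : ℝ => 3 / (2 * T ^ 2)) atTop (nhds 0) :=
        tendsto_const_nhds.div_atTop ((tendsto_pow_atTop two_ne_zero).const_mul_atTop two_pos)
      have a2 := ((Real.tendsto_pow_mul_exp_neg_atTop_nhds_zero 1).comp
        (tendsto_id.const_mul_atTop hx)).const_mul (√3 * x⁻¹)
      have a3 := a1.add a2
      rw [mul_zero, add_zero] at a3
      refine a3.congr fun T => ?_
      simp only [Function.comp, id, pow_one]
      field_simp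
  have h3 := h1.sub h2
  rw [sub_zero] at h3
  have h4 := (Complex.continuous_im.tendsto _).comp h3
  refine h4.congr fun T => ?_
  have h5 := hray 1 T
  simp only [Function.comp, hray]
  rw [show G (((2 * T : ℝ) : ℂ) * scW) - G 0 - (G (((2 * T : ℝ) : ℂ) * scW) - G T) =
    ∫ s in (0:ℝ)..T, 1 * scF x (s * 1) by rw [h5, mul_one]; ring]
  rw [← Complex.imCLM_apply, ← ContinuousLinearMap.intervalIntegral_comp_comm _
    (Continuous.intervalIntegrable (by fun_prop) _ _)]
  refine intervalIntegral.integral_congr fun t _ => ?_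
  simp only [one_mul, mul_one, scF, Complex.imCLM_apply]
  rw [show Complex.I * ((t:ℂ) ^ 3 / 3 + x * t) = ((t ^ 3 / 3 + x * t : ℝ) : ℂ) * Complex.I by
    push_cast; ring, Complex.exp_ofReal_mul_I_im]

lemma sc_main_term (x : ℝ) (hx : 0 < x) (k : ℕ) :
    scW * ∫ s : ℝ in Set.Ioi 0, (-(Complex.I * ((s ^ 3 / 3 : ℝ) : ℂ))) ^ k / (k.factorial : ℂ) *
      Complex.exp (-((-(Complex.I * x * scW)) * s)) =
    (((1 / x) * (((3 * k).factorial : ℝ) / ((k.factorial : ℝ) * (3 * x ^ 3) ^ k)) : ℝ) : ℂ)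
      * Complex.I := by
  have ha : 0 < (-(Complex.I * x * scW)).re := by rw [scA_re]; positivity
  have hI := sc_int_cplx _ ha (3 * k)
  have : ∀ s : ℝ, (-(Complex.I * ((s ^ 3 / 3 : ℝ) : ℂ))) ^ k / (k.factorial : ℂ) *
      Complex.exp (-((-(Complex.I * x * scW)) * s)) =
      ((-(Complex.I / 3)) ^ k / (k.factorial : ℂ)) *
        ((s:ℂ) ^ (3 * k) * Complex.exp (-((-(Complex.I * x * scW)) * s))) := by
    intro s
    rw [show (-(Complex.I * ((s ^ 3 / 3 : ℝ) : ℂ))) = -(Complex.I / 3) * (s:ℂ) ^ 3 by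
      push_cast; ring, mul_pow, pow_mul]
    ring
  simp_rw [this]
  rw [MeasureTheory.integral_const_mul, hI]
  have hw : scW ≠ 0 := by rw [← norm_ne_zero_iff, scW_normsq]; norm_num
  have hx' : (x:ℂ) ≠ 0 := by exact_mod_cast hx.ne'
  have hk : (k.factorial : ℂ) ≠ 0 := by exact_mod_cast k.factorial_ne_zero
  have hII : Complex.I ≠ 0 := Complex.I_ne_zero
  have hc : (-(Complex.I * x * scW)) ^ 3 = -(Complex.I / 3) * (3 * (x:ℂ) ^ 3) := by
    linear_combination (-Complex.I ^ 3 * x ^ 3) * scW_cube + (Complex.I * x ^ 3) * Complex.I_sq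
  rw [pow_succ, pow_mul, hc, mul_pow]
  have hp : (-(Complex.I / 3)) ^ k ≠ 0 := pow_ne_zero _ (by simp)
  push_cast
  generalize (-(Complex.I / 3)) ^ k = p at *
  have hq : (3 * (x:ℂ) ^ 3) ^ k ≠ 0 := pow_ne_zero _ (by simp [hx'])
  generalize (3 * (x:ℂ) ^ 3) ^ k = q at *
  field_simp
  rw [Complex.I_sq]
  ring

theorem Gi_asymptotic (x : ℝ) (hx : 0 < x) (n : ℕ) :
    ∃ Gi ε : ℝ,
      Tendsto (fun T : ℝ => (1 / π) * ∫ t in (0:ℝ)..T, Real.sin (t ^ 3 / 3 + x * t))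
        atTop (nhds Gi) ∧
      Gi =
        (1 / (π * x)) *
            (∑ k ∈ Finset.range (n + 1),
              ((3 * k).factorial : ℝ) / ((k.factorial : ℝ) * (3 * x ^ 3) ^ k)) +
          (1 / π) * ε ∧
      |ε| ≤
        ((3 * n + 3).factorial : ℝ) /
          ((3 : ℝ) ^ ((5 * (n : ℝ)) / 2 + 3) * ((n + 1).factorial : ℝ) *
            (x / 2) ^ (3 * n + 4)) := by
  set S := ∑ k ∈ Finset.range (n + 1),
              ((3 * k).factorial : ℝ) / ((k.factorial : ℝ) * (3 * x ^ 3) ^ k) with hS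
  set L := scW * ∫ s : ℝ in Set.Ioi 0, scF x (s * scW) with hL
  refine ⟨1 / π * L.im, L.im - 1 / x * S, (sc_tendsto x hx).const_mul _, ?_, ?_⟩
  · have := Real.pi_ne_zero
    field_simp
    ring
  have ha : 0 < (-(Complex.I * x * scW)).re := by rw [scA_re]; positivity
  set P : ℝ → ℂ := fun s => ∑ k ∈ Finset.range (n + 1),
    (-(Complex.I * ((s ^ 3 / 3 : ℝ) : ℂ))) ^ k / (k.factorial : ℂ) *
      Complex.exp (-((-(Complex.I * x * scW)) * s)) with hP
  have hterm : ∀ k ∈ Finset.range (n + 1), MeasureTheory.IntegrableOn (fun s : ℝ =>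
      (-(Complex.I * ((s ^ 3 / 3 : ℝ) : ℂ))) ^ k / (k.factorial : ℂ) *
      Complex.exp (-((-(Complex.I * x * scW)) * s))) (Set.Ioi 0) := by
    intro k _
    refine MeasureTheory.IntegrableOn.congr_fun ((sc_int_cplx_int _ ha (3 * k)).const_mul
      ((-(Complex.I / 3)) ^ k / (k.factorial : ℂ))) (fun s _ => ?_) measurableSet_Ioi
    rw [show (-(Complex.I * ((s ^ 3 / 3 : ℝ) : ℂ))) = -(Complex.I / 3) * (s:ℂ) ^ 3 by
      push_cast; ring, mul_pow _ _ k, pow_mul]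
    ring
  have hPint : MeasureTheory.IntegrableOn P (Set.Ioi 0) :=
    MeasureTheory.integrable_finsetSum _ hterm
  have hPval : scW * ∫ s : ℝ in Set.Ioi 0, P s = ((1 / x * S : ℝ) : ℂ) * Complex.I := by
    rw [hP, MeasureTheory.integral_finsetSum _ hterm, Finset.mul_sum,
      Finset.sum_congr rfl fun k _ => sc_main_term x hx k, ← Finset.sum_mul, hS, Finset.mul_sum,
      Complex.ofReal_sum]
  have hdiff : L.im - 1 / x * S = (scW * ∫ s : ℝ in Set.Ioi 0, (scF x (s * scW) - P s)).im := by
    rw [MeasureTheory.integral_sub (scF_ray_int x hx) hPint, mul_sub, hPval, ← hL, Complex.sub_im,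
      Complex.im_ofReal_mul, Complex.I_im, mul_one]
  rw [hdiff]
  refine (Complex.abs_im_le_norm _).trans ?_
  rw [norm_mul, scW_normsq, one_mul]
  obtain ⟨i1, i2⟩ := sc_int_real _ ha (3 * n + 3)
  have hb := MeasureTheory.norm_integral_le_of_norm_le
    (f := fun s : ℝ => scF x (s * scW) - P s)
    (i1.const_mul (1 / (3 ^ (n + 1) * ((n + 1).factorial : ℝ)))) (by
      filter_upwards [MeasureTheory.ae_restrict_mem measurableSet_Ioi] with s hs
      have hs0 : 0 ≤ s := le_of_lt hs
      rw [hP, scF_ray]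
      simp only
      rw [← Finset.sum_mul, ← sub_mul, norm_mul, sc_norm_exp, ← mul_assoc]
      refine mul_le_mul_of_nonneg_right ?_ (Real.exp_pos _).le
      refine (sc_taylor (n + 1) (s ^ 3 / 3) (by positivity)).trans (le_of_eq ?_)
      rw [div_pow, ← pow_mul]
      field_simp
      ring)
  refine hb.trans (le_of_eq ?_)
  rw [MeasureTheory.integral_const_mul, i2, scA_re]
  have hr : (3:ℝ) ^ ((5 * (n : ℝ)) / 2 + 3) = 3 ^ (n + 1) * √3 ^ (3 * n + 4) := by
    rw [Real.sqrt_eq_rpow, ← Real.rpow_natCast, ← Real.rpow_natCast, ← Real.rpow_mul (by norm_num),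
      ← Real.rpow_add (by norm_num)]
    congr 1
    push_cast
    ring
  rw [hr, show x * (√3 / 2) = √3 * (x / 2) by ring, mul_pow]
  field_simp
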